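/- Let K be a type and let c, d : {1,…,N} → K be colorings of the upper and lower nodes such that for every k ∈ K the fibers c⁻¹(k) and d⁻¹(k) have the same cardinality. Call a permutation σ of {1,…,N} color-matching if d(σ(x)) = c(x) for all x. Then there exists exactly one color-matching permutation σ that minimizes the number of inversions among all color-matching permutations, namely the unique color-matching permutation satisfying σ(x) < σ(y) for all x < y with c(x) = c(y) (order-preserving on each color class). -/

import Mathlib

/-- The number of inversions of a permutation `σ` of `Fin N`. -/
def inversions {N : ℕ} (σ : Equiv.Perm (Fin N)) : ℕ :=
  (Finset.univ.filter fun p : Fin N × Fin N => p.1 < p.2 ∧ σ p.2 < σ p.1).card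

/-- Uncrossing two crossing edges strictly decreases the number of inversions. -/
theorem inversions_swap_lt {N : ℕ} (σ : Equiv.Perm (Fin N)) (x y : Fin N)
    (hxy : x < y) (hs : σ y < σ x) :
    inversions (σ * Equiv.swap x y) < inversions σ := by
  unfold inversions
  set s := Equiv.swap x y with hsdef
  have hsx : s x = y := Equiv.swap_apply_left x y
  have hsy : s y = x := Equiv.swap_apply_right x y
  have hso : ∀ z, z ≠ x → z ≠ y → s z = z := fun z h1 h2 => Equiv.swap_apply_of_ne_of_ne h1 h2
  have hss : ∀ z, s (s z) = z := fun z => by rw [hsdef, ← Equiv.Perm.mul_apply, Equiv.swap_mul_self, Equiv.Perm.one_apply]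
  have hmem : (x, y) ∈ Finset.univ.filter
      (fun p : Fin N × Fin N => p.1 < p.2 ∧ σ p.2 < σ p.1) := by simp [hxy, hs]
  refine lt_of_le_of_lt ?_ (Finset.card_erase_lt_of_mem hmem)
  refine Finset.card_le_card_of_injOn
    (fun p => if s p.1 < s p.2 then (s p.1, s p.2) else p) ?_ ?_
  · rintro ⟨p, q⟩ h
    replace h : p < q ∧ σ (s q) < σ (s p) := (Finset.mem_filter.mp (Finset.mem_coe.mp h)).2
    obtain ⟨hpq, hi⟩ := h
    simp only [Finset.mem_coe, Finset.mem_erase, Finset.mem_filter, Finset.mem_univ, true_and]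
    split_ifs with hlt
    · refine ⟨?_, hlt, hi⟩
      intro he
      rw [Prod.mk.injEq] at he
      have h1 : p = y := by rw [← hss p, he.1, hsx]
      have h2 : q = x := by rw [← hss q, he.2, hsy]
      subst h1 h2
      exact absurd hpq hxy.not_gt
    · have hne : (p, q) ≠ (x, y) := by
        intro he
        rw [Prod.mk.injEq] at he
        rw [he.1, he.2, hsx, hsy] at hi
        exact absurd hi hs.not_gt
      refine ⟨hne, hpq, ?_⟩
      have hne' : ¬ (p = x ∧ q = y) := by simpa using hne
      show σ q < σ p
      by_cases hpx : p = x
      · have hqy : q ≠ y := fun h => hne' ⟨hpx, h⟩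
        have hqx : q ≠ x := fun h => by rw [hpx, h] at hpq; exact lt_irrefl _ hpq
        rw [hpx, hsx, hso q hqx hqy] at hi
        rw [hpx]
        exact hi.trans hs
      · by_cases hqy : q = y
        · have hpy : p ≠ y := fun h => by rw [hqy, h] at hpq; exact lt_irrefl _ hpq
          rw [hqy, hsy, hso p hpx hpy] at hi
          rw [hqy]
          exact hs.trans hi
        · exfalso
          apply hlt
          by_cases hpy : p = y
          · have hqx : q ≠ x := fun h => by
              rw [hpy, h] at hpq; exact absurd hpq hxy.not_gt
            rw [hpy, hsy, hso q hqx hqy]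
            rw [hpy] at hpq
            exact hxy.trans hpq
          · by_cases hqx : q = x
            · rw [hqx, hsx, hso p hpx hpy]
              rw [hqx] at hpq
              exact hpq.trans hxy
            · rw [hso p hpx hpy, hso q hqx hqy]
              exact hpq
  · rintro ⟨p, q⟩ h ⟨p', q'⟩ h' he
    simp only [Finset.mem_coe, Finset.mem_filter, Finset.mem_univ, true_and] at h h'
    dsimp only at he
    split_ifs at he with h1 h2 h2
    · simpa using he
    · rw [Prod.mk.injEq] at he
      rw [← he.1, ← he.2, hss, hss] at h2
      exact absurd h.1 h2
    · rw [Prod.mk.injEq] at he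
      rw [he.1, he.2, hss, hss] at h1
      exact absurd h'.1 h1
    · exact he

/-- Two color-matching permutations that are monotone on color classes coincide. -/
theorem color_monotone_unique {N : ℕ} {K : Type*} (c d : Fin N → K)
    (σ τ : Equiv.Perm (Fin N)) (hσ : ∀ x, d (σ x) = c x) (hτ : ∀ x, d (τ x) = c x)
    (mσ : ∀ x y : Fin N, x < y → c x = c y → σ x < σ y)
    (mτ : ∀ x y : Fin N, x < y → c x = c y → τ x < τ y) : σ = τ := by
  have key : ∀ (σ τ : Equiv.Perm (Fin N)), (∀ x, d (σ x) = c x) → (∀ x, d (τ x) = c x) →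
      (∀ x y : Fin N, x < y → c x = c y → τ x < τ y) →
      ∀ x, (∀ z, z < x → σ z = τ z) → ¬ σ x < τ x := by
    intro σ τ hσ hτ mτ x ih hlt
    have hz : τ (τ.symm (σ x)) = σ x := τ.apply_symm_apply _
    generalize τ.symm (σ x) = z at hz
    have hc : c x = c z := by rw [← hτ z, hz, hσ]
    rcases lt_trichotomy z x with h | h | h
    · have := ih z h
      rw [hz] at this
      exact h.ne (σ.injective this)
    · rw [← hz, h] at hlt
      exact lt_irrefl _ hlt
    · have := mτ x z h hc
      rw [hz] at this
      exact absurd hlt this.not_gt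
  ext1 x
  induction x using WellFoundedLT.induction with
  | ind x ih =>
    rcases lt_trichotomy (σ x) (τ x) with h | h | h
    · exact absurd h (key σ τ hσ hτ mτ x ih)
    · exact h
    · exact absurd h (key τ σ hτ hσ mσ x fun z hz => (ih z hz).symm)

/-- Let `c`, `d` be colorings of the upper and lower nodes with equal-sized fibers.
Then there is exactly one color-matching permutation minimizing the number of
inversions among all color-matching permutations, namely the unique color-matching
permutation that is order-preserving on each color class. -/
theorem unique_minimal_color_matching {N : ℕ} {K : Type*} [DecidableEq K]
    (c d : Fin N → K)
    (hfib : ∀ k : K, (Finset.univ.filter fun x : Fin N => c x = k).card =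
      (Finset.univ.filter fun x : Fin N => d x = k).card) :
    (∃! σ : Equiv.Perm (Fin N), (∀ x : Fin N, d (σ x) = c x) ∧
      ∀ π : Equiv.Perm (Fin N), (∀ x : Fin N, d (π x) = c x) →
        inversions σ ≤ inversions π) ∧
    (∀ σ : Equiv.Perm (Fin N),
      ((∀ x : Fin N, d (σ x) = c x) ∧
        ∀ π : Equiv.Perm (Fin N), (∀ x : Fin N, d (π x) = c x) →
          inversions σ ≤ inversions π) ↔
      ((∀ x : Fin N, d (σ x) = c x) ∧
        ∀ x y : Fin N, x < y → c x = c y → σ x < σ y)) := by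
  have hmono : ∀ σ : Equiv.Perm (Fin N), (∀ x : Fin N, d (σ x) = c x) →
      (∀ π : Equiv.Perm (Fin N), (∀ x : Fin N, d (π x) = c x) →
        inversions σ ≤ inversions π) →
      ∀ x y : Fin N, x < y → c x = c y → σ x < σ y := by
    intro σ hσ hmin x y hxy hc
    by_contra hn
    have hs : σ y < σ x :=
      lt_of_le_of_ne (not_lt.mp hn) fun h => hxy.ne (σ.injective h).symm
    refine absurd (hmin (σ * Equiv.swap x y) ?_) (inversions_swap_lt σ x y hxy hs).not_ge
    intro z
    rw [Equiv.Perm.mul_apply, hσ]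
    by_cases hzx : z = x
    · rw [hzx, Equiv.swap_apply_left, hc]
    · by_cases hzy : z = y
      · rw [hzy, Equiv.swap_apply_right, hc]
      · rw [Equiv.swap_apply_of_ne_of_ne hzx hzy]
  have hex : ∃ π : Equiv.Perm (Fin N), ∀ x : Fin N, d (π x) = c x := by
    have e : ∀ k : K, Nonempty ({x // c x = k} ≃ {x // d x = k}) := fun k =>
      Fintype.card_eq.mp (by rw [Fintype.card_subtype, Fintype.card_subtype, hfib k])
    exact ⟨Equiv.ofFiberEquiv fun k => (e k).some, fun x => Equiv.ofFiberEquiv_map _ x⟩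
  obtain ⟨π₀, hπ₀⟩ := hex
  obtain ⟨μ, hμ, hμmin⟩ := Finset.exists_min_image
    (Finset.univ.filter fun π : Equiv.Perm (Fin N) => ∀ x : Fin N, d (π x) = c x)
    inversions ⟨π₀, by simpa using hπ₀⟩
  replace hμ : ∀ x : Fin N, d (μ x) = c x := by simpa using hμ
  replace hμmin : ∀ π : Equiv.Perm (Fin N), (∀ x : Fin N, d (π x) = c x) →
      inversions μ ≤ inversions π := fun π hπ => hμmin π (by simpa using hπ)
  have hμmono := hmono μ hμ hμmin
  refine ⟨⟨μ, ⟨hμ, hμmin⟩, ?_⟩, ?_⟩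
  · rintro σ ⟨hσ, hσmin⟩
    exact color_monotone_unique c d σ μ hσ hμ (hmono σ hσ hσmin) hμmono
  · intro σ
    constructor
    · rintro ⟨hσ, hσmin⟩
      exact ⟨hσ, hmono σ hσ hσmin⟩
    · rintro ⟨hσ, hσm⟩
      have := color_monotone_unique c d σ μ hσ hμ hσm hμmono
      rw [this]
      exact ⟨hμ, hμmin⟩
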